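/- Let s ∈ [0, 1/2], ρ₂ ≥ 3/16 + (5/8)s, ρ₃ ≥ 1/4 + (1/2)s, and ε > 0. Then there exists a constant C > 0 such that for all f, g, h whose spacetime Fourier transforms are nonnegative (with ξ = ξ₁+ξ₂): (i) I_{m}(f̂,ĝ,ĥ) ≤ C ‖f‖_{X_{0,ρ₂+ε}} ‖g‖_{L²(ℝ²)} ‖h‖_{Y_{0,1/2+ε}} with weight m(ξ₁,ξ₂) = |3ξ₂² + 2ξ|^{s}; (ii) I_{m}(f̂,ĝ,ĥ) ≤ C ‖f‖_{X_{0,ρ₃+ε}} ‖g‖_{X_{0,1/2+ε}} ‖h‖_{L²(ℝ²)} with weight m(ξ₁,ξ₂) = |ξ₂|^{s}. -/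

import Mathlib

open MeasureTheory Real Set
open scoped ENNReal NNReal

noncomputable section

/-- Spacetime Fourier transform of `f : ℝ × ℝ → ℂ` (`p.1` = space frequency ξ, `p.2` = time frequency τ). -/
def FT2 (f : ℝ × ℝ → ℂ) : ℝ × ℝ → ℂ :=
  fun p => ∫ q : ℝ × ℝ,
    Complex.exp (-(2 * Real.pi * (q.1 * p.1 + q.2 * p.2)) * Complex.I) • f q

/-- Japanese bracket `⟨a⟩ = (1+a²)^{1/2}`. -/
def jb (a : ℝ) : ℝ := Real.sqrt (1 + a ^ 2)

/-- The Bourgain norm `‖f‖_{X_{s,b}(φ)}`, as an `ℝ≥0∞`-valued quantity. -/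
def XNorm (φ : ℝ → ℝ) (s b : ℝ) (f : ℝ × ℝ → ℂ) : ℝ≥0∞ :=
  (∫⁻ p : ℝ × ℝ,
    ENNReal.ofReal (jb p.1 ^ (2 * s) * jb (p.2 + φ p.1) ^ (2 * b) * ‖FT2 f p‖ ^ 2)) ^ (1/2 : ℝ)

/-- Schrödinger phase `φ(ξ) = ξ²`. -/
def SchPhase : ℝ → ℝ := fun ξ => ξ ^ 2

/-- Conjugate Schrödinger phase `φ(ξ) = -ξ²`. -/
def SchPhaseNeg : ℝ → ℝ := fun ξ => -ξ ^ 2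

/-- Airy (KdV) phase `φ(ξ) = -ξ³`. -/
def AiryPhase : ℝ → ℝ := fun ξ => -ξ ^ 3

/-- `f` has a nonnegative (real-valued) spacetime Fourier transform. -/
def HasNonnegFT (f : ℝ × ℝ → ℂ) : Prop :=
  ∀ p, (FT2 f p).im = 0 ∧ 0 ≤ (FT2 f p).re

/-- The weighted trilinear functional `I_m(f̂,ĝ,ĥ)`, applied here directly to
the Fourier transforms `F = f̂`, `G = ĝ`, `H = ĥ` (assumed nonnegative). -/
def Itri (m : ℝ → ℝ → ℝ) (F G H : ℝ × ℝ → ℂ) : ℝ≥0∞ :=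
  ∫⁻ q : (ℝ × ℝ) × (ℝ × ℝ),
    ENNReal.ofReal
      (m q.1.1 q.2.1 * (F (q.1.1 + q.2.1, q.1.2 + q.2.2)).re * (G q.1).re * (H q.2).re)

/-- Partial derivative in the spatial variable `x` (first coordinate). -/
def partialX (f : ℝ × ℝ → ℂ) : ℝ × ℝ → ℂ :=
  fun p => deriv (fun x => f (x, p.2)) p.1

/-- Multiplication by the rescaled time cutoff, `(ψ(t/δ)f)(x,t) = ψ(t/δ) f(x,t)`. -/
def timeCut (ψ : ℝ → ℝ) (δ : ℝ) (f : ℝ × ℝ → ℂ) : ℝ × ℝ → ℂ :=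
  fun p => (ψ (p.2 / δ) : ℂ) * f p

/-- `ψ` is a fixed even smooth bump, `0 ≤ ψ ≤ 1`, `ψ ≡ 1` on `[-1,1]`, supp ψ ⊆ `[-2,2]`. -/
def IsTimeBump (ψ : ℝ → ℝ) : Prop :=
  ContDiff ℝ (⊤ : ℕ∞) ψ ∧ HasCompactSupport ψ ∧ (∀ t, ψ (-t) = ψ t) ∧
  (∀ t, 0 ≤ ψ t ∧ ψ t ≤ 1) ∧ (∀ t ∈ Set.Icc (-1 : ℝ) 1, ψ t = 1) ∧
  Function.support ψ ⊆ Set.Icc (-2 : ℝ) 2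

/-- `m` is an admissible symbol `m_{N,s}` for the smoothing operator `I_{N,s}`. -/
def IsISymbol (N s : ℝ) (m : ℝ → ℝ) : Prop :=
  ContDiff ℝ (⊤ : ℕ∞) m ∧ (∀ ξ, m (-ξ) = m ξ) ∧
  (∀ ξ, 0 < m ξ ∧ m ξ ≤ 1) ∧
  (∀ ξ η, |ξ| ≤ |η| → m η ≤ m ξ) ∧
  (∀ ξ, |ξ| ≤ N → m ξ = 1) ∧
  (∀ ξ, 2 * N ≤ |ξ| → m ξ = N ^ (1 - s) * |ξ| ^ (s - 1))

/-- Inverse spacetime Fourier transform. -/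
def invFT2 (f : ℝ × ℝ → ℂ) : ℝ × ℝ → ℂ :=
  fun p => ∫ q : ℝ × ℝ,
    Complex.exp ((2 * Real.pi * (q.1 * p.1 + q.2 * p.2)) * Complex.I) • f q

/-- The Fourier multiplier operator (in `x`) with symbol `m(ξ)`. -/
def Iop (m : ℝ → ℝ) (f : ℝ × ℝ → ℂ) : ℝ × ℝ → ℂ :=
  invFT2 (fun q => (m q.1 : ℂ) * FT2 f q)

/-- The restricted Bourgain norm `‖f‖_{X^E_{s,b}(φ)}`. -/
def XRestNorm (φ : ℝ → ℝ) (s b : ℝ) (E : Set ℝ) (f : ℝ × ℝ → ℂ) : ℝ≥0∞ :=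
  ⨅ F ∈ {F : ℝ × ℝ → ℂ | XNorm φ s b F < ⊤ ∧ ∀ x t, t ∈ E → F (x, t) = f (x, t)},
    XNorm φ s b F


section planch
open FourierTransform SchwartzMap

lemma fcont {E : Type*} [NormedAddCommGroup E] [MeasurableSpace E] [BorelSpace E]
    [InnerProductSpace ℝ E] [FiniteDimensional ℝ E] (g : E → ℂ) (hg : Integrable g) :
    Continuous (𝓕 g) :=
  VectorFourier.fourierIntegral_continuous Real.continuous_fourierChar
      (by simpa using continuous_inner) hg

lemma planch_E {E : Type*} [NormedAddCommGroup E] [MeasurableSpace E] [BorelSpace E]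
    [InnerProductSpace ℝ E] [FiniteDimensional ℝ E] (g : E → ℂ) (hg : Integrable g)
    (hg2 : MemLp g 2) : eLpNorm (𝓕 g) 2 volume = eLpNorm g 2 volume := by
  set G : Lp (α := E) ℂ 2 := hg2.toLp g with hG
  have hcont : Continuous (𝓕 g) := fcont g hg
  have key : ∀ᵐ x ∂(volume : Measure E), (𝓕 g) x = (𝓕 G : Lp (α := E) ℂ 2 volume) x := by
    apply ae_eq_of_integral_contDiff_smul_eq hcont.locallyIntegrable
    · exact (Lp.memLp (𝓕 G)).locallyIntegrable (by norm_num)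
    intro φ hφ hφc
    have hc : HasCompactSupport (fun x => (φ x : ℂ)) := hφc.comp_left (g := fun r : ℝ => (r:ℂ)) (by simp)
    have hd : ContDiff ℝ (⊤ : ℕ∞) (fun x => (φ x : ℂ)) := Complex.ofRealCLM.contDiff.comp hφ
    set Φ : 𝓢(E, ℂ) := hc.toSchwartzMap hd with hΦ
    have hΦx : ∀ x, Φ x = (φ x : ℂ) := fun x => rfl
    have h1 := congrArg (fun T => T Φ) (Lp.fourier_toTemperedDistribution_eq G)
    simp only [TemperedDistribution.fourier_apply, Lp.toTemperedDistribution_apply] at h1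
    have h2 : ∫ x, (𝓕 g) x • Φ x = ∫ x, g x • (𝓕 (Φ : E → ℂ)) x := by
      have := VectorFourier.integral_fourierIntegral_smul_eq_flip (μ := (volume : Measure E))
        (ν := (volume : Measure E)) (L := innerₗ E) (f := g) (g := (Φ : E → ℂ))
        Real.continuous_fourierChar (by simpa using continuous_inner) hg Φ.integrable
      rw [flip_innerₗ] at this
      exact this
    have h3 : ∫ x, (𝓕 Φ) x • (G x) = ∫ x, g x • (𝓕 (Φ : E → ℂ)) x := by
      apply integral_congr_ae
      filter_upwards [hg2.coeFn_toLp] with x hx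
      rw [hG, hx, smul_eq_mul, smul_eq_mul, mul_comm, SchwartzMap.fourier_coe]
    calc ∫ x, φ x • (𝓕 g) x = ∫ x, (𝓕 g) x • Φ x := by
          congr 1; ext x; simp [hΦx, mul_comm]
      _ = ∫ x, Φ x • (𝓕 G : Lp (α := E) ℂ 2 volume) x := by rw [h2, ← h3, h1]
      _ = _ := by congr 1
  rw [eLpNorm_congr_ae key]
  have := Lp.norm_fourier_eq G
  rw [Lp.norm_def, Lp.norm_def, ENNReal.toReal_eq_toReal_iff' (Lp.eLpNorm_ne_top _) (Lp.eLpNorm_ne_top _)] at this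
  rw [this]
  exact eLpNorm_congr_ae hg2.coeFn_toLp

lemma FT2_eq (g : ℝ × ℝ → ℂ) (p : ℝ × ℝ) :
    FT2 g p = 𝓕 (fun x : WithLp 2 (ℝ × ℝ) => g x.ofLp) (WithLp.toLp 2 p) := by
  rw [Real.fourier_eq']
  rw [← (WithLp.volume_preserving_toLp ℝ ℝ).integral_comp
    (MeasurableEquiv.toLp 2 (ℝ × ℝ)).measurableEmbedding]
  unfold FT2
  congr 1; ext q
  congr 2
  simp [WithLp.prod_inner_apply]
  ring

lemma FT2_continuous (g : ℝ × ℝ → ℂ) : Continuous (FT2 g) := by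
  by_cases hg : Integrable g
  · have h1 : Integrable (fun x : WithLp 2 (ℝ × ℝ) => g x.ofLp) :=
      (WithLp.volume_preserving_ofLp ℝ ℝ).integrable_comp_of_integrable hg
    have hcont : Continuous (𝓕 (fun x : WithLp 2 (ℝ × ℝ) => g x.ofLp)) :=
      fcont _ h1
    have : FT2 g = fun p => 𝓕 (fun x : WithLp 2 (ℝ × ℝ) => g x.ofLp) (WithLp.toLp 2 p) :=
      funext (FT2_eq g)
    rw [this]
    exact hcont.comp (WithLp.prod_continuous_toLp 2 ℝ ℝ)
  · have : FT2 g = fun _ => 0 := by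
      ext p
      rw [FT2_eq]
      apply integral_undef
      intro h
      apply hg
      replace h := (Real.fourierIntegral_convergent_iff _).1 h
      have := (WithLp.volume_preserving_toLp ℝ ℝ).integrable_comp_of_integrable h
      exact this
    rw [this]; exact continuous_const

lemma planch (g : ℝ × ℝ → ℂ) :
    (∫⁻ p, ENNReal.ofReal ‖FT2 g p‖ ^ 2) ^ (1/2 : ℝ) ≤ eLpNorm g 2 volume := by
  have e0 : (∫⁻ p, ENNReal.ofReal ‖FT2 g p‖ ^ 2) ^ (1/2 : ℝ) = eLpNorm (FT2 g) 2 volume := by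
    rw [eLpNorm_eq_lintegral_rpow_enorm_toReal (by norm_num) (by norm_num)]
    simp
  rw [e0]
  by_cases hg : Integrable g
  · by_cases hg2 : MemLp g 2
    · set g' := (fun x : WithLp 2 (ℝ × ℝ) => g x.ofLp) with hg'
      have h1 : Integrable g' :=
        (WithLp.volume_preserving_ofLp ℝ ℝ).integrable_comp_of_integrable hg
      have h2 : MemLp g' 2 := hg2.comp_measurePreserving (WithLp.volume_preserving_ofLp ℝ ℝ)
      have h3 := planch_E g' h1 h2
      have h4 : eLpNorm g' 2 volume = eLpNorm g 2 volume :=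
        eLpNorm_comp_measurePreserving hg.1 (WithLp.volume_preserving_ofLp ℝ ℝ)
      have hcont : Continuous (𝓕 g') :=
        fcont _ h1
      have h5 : eLpNorm (𝓕 g' ∘ WithLp.toLp 2) 2 volume = eLpNorm (𝓕 g') 2 volume :=
        eLpNorm_comp_measurePreserving hcont.aestronglyMeasurable
          (WithLp.volume_preserving_toLp ℝ ℝ)
      have h6 : FT2 g = 𝓕 g' ∘ WithLp.toLp 2 := funext (FT2_eq g)
      rw [h6, h5, h3, h4]
    · have : eLpNorm g 2 volume = ⊤ := by
        by_contra h
        exact hg2 ⟨hg.1, lt_top_iff_ne_top.2 h⟩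
      rw [this]; exact le_top
  · have : FT2 g = 0 := by
      ext p
      rw [FT2_eq]
      apply integral_undef
      intro h
      apply hg
      replace h := (Real.fourierIntegral_convergent_iff _).1 h
      exact (WithLp.volume_preserving_toLp ℝ ℝ).integrable_comp_of_integrable h
    rw [this]; simp
end planch

section oneD

lemma jb_one_le (a : ℝ) : 1 ≤ jb a := by
  unfold jb; rw [Real.one_le_sqrt]; nlinarith [sq_nonneg a]

lemma jb_pos (a : ℝ) : 0 < jb a := lt_of_lt_of_le one_pos (jb_one_le a)

lemma jb_cont : Continuous jb := by unfold jb; fun_prop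

@[fun_prop]
lemma jb_meas : Measurable jb := jb_cont.measurable

lemma jb_mono {a b : ℝ} (h : |a| ≤ |b|) : jb a ≤ jb b := by
  unfold jb
  apply Real.sqrt_le_sqrt
  have := sq_le_sq.2 h
  linarith

lemma jb_rpow_cont (r : ℝ) : Continuous (fun x => jb x ^ r) :=
  jb_cont.rpow_const (fun x => Or.inl (jb_pos x).ne')

lemma jb_rpow_meas (r : ℝ) : Measurable (fun x => jb x ^ r) := (jb_rpow_cont r).measurable

def Jint (r : ℝ) : ℝ≥0∞ := ∫⁻ x : ℝ, ENNReal.ofReal (jb x ^ (-r))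

lemma Jint_lt_top {r : ℝ} (hr : 1 < r) : Jint r < ⊤ := by
  have h := integrable_rpow_neg_one_add_norm_sq (E := ℝ) (μ := volume) (r := r) (by simpa using hr)
  have h2 := h.lintegral_lt_top
  unfold Jint
  convert h2 using 3 with x
  congr 1
  unfold jb
  rw [Real.sqrt_eq_rpow, ← Real.rpow_mul (by positivity)]
  congr 1
  · simp
  · ring

lemma L1piece (a c r : ℝ) (S : Set ℝ) (hS : MeasurableSet S)
    (hinj : InjOn (fun x : ℝ => c + (a + x) ^ 2 + x ^ 3) S) :
    ∫⁻ x in S, ENNReal.ofReal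
      (|3 * x ^ 2 + 2 * (a + x)| * jb (c + (a + x) ^ 2 + x ^ 3) ^ (-r)) ≤ Jint r := by
  have hd : ∀ x ∈ S, HasDerivWithinAt (fun x : ℝ => c + (a + x) ^ 2 + x ^ 3)
      (3 * x ^ 2 + 2 * (a + x)) S x := by
    intro x _
    apply HasDerivAt.hasDerivWithinAt
    have h1 : HasDerivAt (fun x : ℝ => a + x) 1 x := (hasDerivAt_id x).const_add a
    have h2 := ((h1.pow 2).const_add c).add (hasDerivAt_pow 3 x)
    exact h2.congr_deriv (by norm_num; ring)
  have h := lintegral_image_eq_lintegral_abs_deriv_mul hS hd hinj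
    (fun y => ENNReal.ofReal (jb y ^ (-r)))
  calc _ = ∫⁻ x in S, ENNReal.ofReal |3 * x ^ 2 + 2 * (a + x)| *
        ENNReal.ofReal (jb (c + (a + x) ^ 2 + x ^ 3) ^ (-r)) := by
        congr 1; ext x; rw [ENNReal.ofReal_mul (abs_nonneg _)]
    _ = _ := h.symm
    _ ≤ _ := setLIntegral_le_lintegral _ _

lemma L1 (a c r : ℝ) :
    ∫⁻ x, ENNReal.ofReal
      (|3 * x ^ 2 + 2 * (a + x)| * jb (c + (a + x) ^ 2 + x ^ 3) ^ (-r)) ≤ 3 * Jint r := by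
  set A : Set ℝ := {x | -1/3 ≤ x ∧ 0 < 3 * x ^ 2 + 2 * (a + x)} with hA
  set B : Set ℝ := {x | x ≤ -1/3 ∧ 0 < 3 * x ^ 2 + 2 * (a + x)} with hB
  set D : Set ℝ := {x | 3 * x ^ 2 + 2 * (a + x) < 0} with hD
  have mP : MeasurableSet {x : ℝ | 0 < 3 * x ^ 2 + 2 * (a + x)} :=
    measurableSet_lt measurable_const (by fun_prop)
  have mA : MeasurableSet A := by
    have : A = Ici (-1/3) ∩ {x : ℝ | 0 < 3 * x ^ 2 + 2 * (a + x)} := rfl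
    rw [this]; exact measurableSet_Ici.inter mP
  have mB : MeasurableSet B := by
    have : B = Iic (-1/3) ∩ {x : ℝ | 0 < 3 * x ^ 2 + 2 * (a + x)} := rfl
    rw [this]; exact measurableSet_Iic.inter mP
  have mD : MeasurableSet D := measurableSet_lt
    (f := fun x : ℝ => 3 * x ^ 2 + 2 * (a + x)) (by fun_prop) measurable_const
  have fac : ∀ x y : ℝ, c + (a + x) ^ 2 + x ^ 3 = c + (a + y) ^ 2 + y ^ 3 →
      x = y ∨ x ^ 2 + x * y + y ^ 2 + x + y + 2 * a = 0 := by
    intro x y h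
    have : (x - y) * (x ^ 2 + x * y + y ^ 2 + x + y + 2 * a) = 0 := by linear_combination h
    rcases mul_eq_zero.1 this with h | h
    · left; linarith
    · right; exact h
  have iA : InjOn (fun x : ℝ => c + (a + x) ^ 2 + x ^ 3) A := by
    rintro x ⟨hx1, hx2⟩ y ⟨hy1, hy2⟩ h
    rcases fac x y h with h | h
    · exact h
    · exfalso
      rcases le_total x y with hxy | hxy
      · nlinarith [mul_nonneg (sub_nonneg.2 hxy) (by linarith : (0:ℝ) ≤ x + 1/3),
          sq_nonneg (y - x)]
      · nlinarith [mul_nonneg (sub_nonneg.2 hxy) (by linarith : (0:ℝ) ≤ y + 1/3),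
          sq_nonneg (y - x)]
  have iB : InjOn (fun x : ℝ => c + (a + x) ^ 2 + x ^ 3) B := by
    rintro x ⟨hx1, hx2⟩ y ⟨hy1, hy2⟩ h
    rcases fac x y h with h | h
    · exact h
    · exfalso
      rcases le_total x y with hxy | hxy
      · nlinarith [mul_nonneg (sub_nonneg.2 hxy) (by linarith : (0:ℝ) ≤ -(y + 1/3)),
          sq_nonneg (y - x)]
      · nlinarith [mul_nonneg (sub_nonneg.2 hxy) (by linarith : (0:ℝ) ≤ -(x + 1/3)),
          sq_nonneg (y - x)]
  have iD : InjOn (fun x : ℝ => c + (a + x) ^ 2 + x ^ 3) D := by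
    intro x hx y hy h
    have hx : 3 * x ^ 2 + 2 * (a + x) < 0 := hx
    have hy : 3 * y ^ 2 + 2 * (a + y) < 0 := hy
    rcases fac x y h with h | h
    · exact h
    · exfalso
      nlinarith [sq_nonneg (y - x)]
  set F : ℝ → ℝ≥0∞ := fun x => ENNReal.ofReal
      (|3 * x ^ 2 + 2 * (a + x)| * jb (c + (a + x) ^ 2 + x ^ 3) ^ (-r)) with hF
  have hle : ∀ x, F x ≤ A.indicator F x + B.indicator F x + D.indicator F x := by
    intro x
    rcases lt_trichotomy (3 * x ^ 2 + 2 * (a + x)) 0 with h | h | h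
    · have : x ∈ D := h
      rw [indicator_of_mem this]; exact le_add_self
    · simp [hF, h]
    · rcases le_total (-1/3) x with h' | h'
      · have : x ∈ A := ⟨h', h⟩
        rw [indicator_of_mem this, add_assoc]; exact le_self_add
      · have : x ∈ B := ⟨h', h⟩
        rw [indicator_of_mem this, add_comm (A.indicator F x), add_assoc]; exact le_self_add
  have mF : Measurable F := by
    have := jb_rpow_meas (-r)
    apply Measurable.ennreal_ofReal
    apply Measurable.mul (by fun_prop)
    exact this.comp (by fun_prop)
  calc ∫⁻ x, F x ≤ ∫⁻ x, (A.indicator F x + B.indicator F x + D.indicator F x) :=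
        lintegral_mono hle
    _ = (∫⁻ x in A, F x) + (∫⁻ x in B, F x) + (∫⁻ x in D, F x) := by
        have mAB : Measurable (fun x => A.indicator F x + B.indicator F x) :=
          (mF.indicator mA).add (mF.indicator mB)
        rw [lintegral_add_left mAB,
          lintegral_add_left (mF.indicator mA), lintegral_indicator mA, lintegral_indicator mB,
          lintegral_indicator mD]
    _ ≤ Jint r + Jint r + Jint r :=
        add_le_add (add_le_add (L1piece a c r A mA iA) (L1piece a c r B mB iB))
          (L1piece a c r D mD iD)
    _ = 3 * Jint r := by ring

lemma cubic_lower (a c : ℝ) : ∃ u v w : ℝ, ∀ x : ℝ,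
    |x - u| * |x - v| * |x - w| ≤ |c + (a + x) ^ 2 + x ^ 3| := by
  set P : Cubic ℝ := ⟨1, 1, 2 * a, c + a ^ 2⟩ with hP
  have ha : P.a ≠ 0 := by simp [hP]
  obtain ⟨u, v, w, h⟩ := (Cubic.splits_iff_roots_eq_three (φ := Complex.ofRealHom) ha).1
    (IsAlgClosed.splits _)
  refine ⟨u.re, v.re, w.re, fun x => ?_⟩
  have hb := Cubic.b_eq_three_roots ha h
  have hc := Cubic.c_eq_three_roots ha h
  have hd := Cubic.d_eq_three_roots ha h
  simp [hP] at hb hc hd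
  have e : ((c + (a + x) ^ 2 + x ^ 3 : ℝ) : ℂ) = (x - u) * (x - v) * (x - w) := by
    push_cast
    linear_combination (x:ℂ)^2 * hb + x * hc + hd
  have e2 : |c + (a + x) ^ 2 + x ^ 3| = ‖(x - u : ℂ)‖ * ‖(x - v : ℂ)‖ * ‖(x - w : ℂ)‖ := by
    rw [← norm_mul, ← norm_mul, ← e, Complex.norm_real, Real.norm_eq_abs]
  rw [e2]
  have hz : ∀ z : ℂ, |x - z.re| ≤ ‖(x - z : ℂ)‖ := fun z => by
    simpa using Complex.abs_re_le_norm (x - z : ℂ)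
  gcongr <;> apply hz

lemma jb_cube (x : ℝ) : jb x ^ 3 / 2 ≤ jb (x ^ 3) := by
  have h1 := jb_pos x
  have h2 : jb x ^ 2 = 1 + x ^ 2 := Real.sq_sqrt (by positivity)
  unfold jb at *
  apply Real.le_sqrt_of_sq_le
  have : (√(1 + x ^ 2) ^ 3 / 2) ^ 2 = (√(1 + x ^ 2) ^ 2) ^ 3 / 4 := by ring
  rw [this, h2]
  nlinarith [mul_nonneg (by positivity : (0:ℝ) ≤ 1 + x^2) (sq_nonneg (x ^ 2 - 1))]

lemma L2 {p : ℝ} (hp : 1/3 < p) (a c : ℝ) :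
    ∫⁻ x, ENNReal.ofReal (jb (c + (a + x) ^ 2 + x ^ 3) ^ (-p))
      ≤ 3 * (ENNReal.ofReal (2 ^ p) * Jint (3 * p)) := by
  obtain ⟨u, v, w, h⟩ := cubic_lower a c
  set Q : ℝ → ℝ≥0∞ := fun x => ENNReal.ofReal (2 ^ p) * ENNReal.ofReal (jb x ^ (-(3 * p))) with hQ
  have mQ : Measurable Q := by
    have := jb_rpow_meas (-(3*p))
    exact (this.ennreal_ofReal).const_mul _
  have key : ∀ y d : ℝ, |d| ^ 3 ≤ |y| → ENNReal.ofReal (jb y ^ (-p)) ≤ Q d := by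
    intro y d hyd
    show _ ≤ ENNReal.ofReal (2 ^ p) * ENNReal.ofReal (jb d ^ (-(3 * p)))
    rw [← ENNReal.ofReal_mul (by positivity)]
    apply ENNReal.ofReal_le_ofReal
    have h1 : jb d ^ 3 / 2 ≤ jb y := (jb_cube d).trans (jb_mono (by rwa [abs_pow]))
    have hd := jb_pos d
    calc jb y ^ (-p) ≤ (jb d ^ 3 / 2) ^ (-p) :=
          Real.rpow_le_rpow_of_nonpos (by positivity) h1 (by linarith)
      _ = 2 ^ p * jb d ^ (-(3 * p)) := by
          rw [Real.div_rpow (by positivity) (by norm_num), Real.rpow_neg (by norm_num : (0:ℝ) ≤ 2),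
            div_inv_eq_mul, mul_comm, ← Real.rpow_natCast, ← Real.rpow_mul hd.le]
          congr 2; push_cast; ring
  have hle : ∀ x, ENNReal.ofReal (jb (c + (a + x) ^ 2 + x ^ 3) ^ (-p)) ≤
      Q (x - u) + Q (x - v) + Q (x - w) := by
    intro x
    have hx := h x
    have e1 := abs_nonneg (x - u)
    have e2 := abs_nonneg (x - v)
    have e3 := abs_nonneg (x - w)
    have gen : ∀ m : ℝ, 0 ≤ m → m ≤ |x - u| → m ≤ |x - v| → m ≤ |x - w| →
        m ^ 3 ≤ |c + (a + x) ^ 2 + x ^ 3| := by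
      intro m m0 m1 m2 m3
      refine le_trans ?_ hx
      calc m ^ 3 = m * m * m := by ring
        _ ≤ _ := by gcongr
    by_cases c1 : |x - u| ≤ |x - v| ∧ |x - u| ≤ |x - w|
    · refine (key _ (x - u) (gen _ e1 le_rfl c1.1 c1.2)).trans ?_
      rw [add_assoc]; exact le_self_add
    · by_cases c2 : |x - v| ≤ |x - u| ∧ |x - v| ≤ |x - w|
      · refine (key _ (x - v) (gen _ e2 c2.1 le_rfl c2.2)).trans ?_
        rw [add_comm (Q (x - u)), add_assoc]; exact le_self_add
      · have c3 : |x - w| ≤ |x - u| ∧ |x - w| ≤ |x - v| := by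
          by_contra c3
          grind
        exact (key _ (x - w) (gen _ e3 c3.1 c3.2 le_rfl)).trans le_add_self
  have iQ : ∀ z, ∫⁻ x, Q (x - z) = ENNReal.ofReal (2 ^ p) * Jint (3 * p) := by
    intro z
    rw [lintegral_sub_right_eq_self (μ := volume) Q z, hQ, lintegral_const_mul, Jint]
    exact (jb_rpow_meas (-(3*p))).ennreal_ofReal
  calc _ ≤ ∫⁻ x, (Q (x - u) + Q (x - v) + Q (x - w)) := lintegral_mono hle
    _ = 3 * (ENNReal.ofReal (2 ^ p) * Jint (3 * p)) := by
      rw [lintegral_add_left (by fun_prop), lintegral_add_left (by fun_prop), iQ, iQ, iQ]; ring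

lemma L3 {s b ε : ℝ} (hs : s ∈ Set.Icc (0 : ℝ) (1/2)) (hb : 3/16 + (5/8 : ℝ) * s + ε ≤ b)
    (hε : 0 < ε) : ∃ M : ℝ≥0∞, M < ⊤ ∧ ∀ a c : ℝ,
    ∫⁻ x, ENNReal.ofReal
      ((|3 * x ^ 2 + 2 * (a + x)| ^ s) ^ 2 * (jb (c + (a + x) ^ 2 + x ^ 3) ^ (-b)) ^ 2) ≤ M := by
  refine ⟨3 * Jint (1 + 2 * ε) + 3 * (ENNReal.ofReal (2 ^ (3/8 + 2 * ε)) * Jint (3 * (3/8 + 2 * ε))),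
    ?_, fun a c => ?_⟩
  · have h1 := Jint_lt_top (r := 1 + 2 * ε) (by linarith)
    have h2 := Jint_lt_top (r := 3 * (3/8 + 2 * ε)) (by linarith)
    exact ENNReal.add_lt_top.2 ⟨ENNReal.mul_lt_top (by simp) h1,
      ENNReal.mul_lt_top (by simp) (ENNReal.mul_lt_top (by simp) h2)⟩
  have mF : Measurable (fun x : ℝ => ENNReal.ofReal
      (|3 * x ^ 2 + 2 * (a + x)| * jb (c + (a + x) ^ 2 + x ^ 3) ^ (-(1 + 2 * ε)))) := by
    have := jb_rpow_meas (-(1 + 2 * ε))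
    apply Measurable.ennreal_ofReal
    apply Measurable.mul (by fun_prop)
    exact this.comp (by fun_prop)
  refine le_trans (lintegral_mono (fun x => ?_)) ((lintegral_add_left mF _).le.trans
    (add_le_add (L1 a c (1 + 2 * ε)) (L2 (p := 3/8 + 2 * ε) (by linarith) a c)))
  set y := c + (a + x) ^ 2 + x ^ 3
  set d := |3 * x ^ 2 + 2 * (a + x)| with hd
  have hd0 : 0 ≤ d := abs_nonneg _
  have hj := jb_pos y
  have hj1 := jb_one_le y
  show _ ≤ ENNReal.ofReal _ + ENNReal.ofReal _
  rw [← ENNReal.ofReal_add (by positivity) (by positivity)]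
  apply ENNReal.ofReal_le_ofReal
  have e1 : (d ^ s) ^ 2 = d ^ (2 * s) := by
    rw [← Real.rpow_natCast, ← Real.rpow_mul hd0]; congr 1; push_cast; ring
  have e2 : (jb y ^ (-b)) ^ 2 = jb y ^ (-(2 * b)) := by
    rw [← Real.rpow_natCast, ← Real.rpow_mul hj.le]; congr 1; push_cast; ring
  rw [e1, e2]
  have e3 : jb y ^ (-(2 * b)) ≤ jb y ^ (-(5/8 * (2 * s))) * jb y ^ (-(3/8 + 2 * ε)) := by
    rw [← Real.rpow_add hj]
    exact Real.rpow_le_rpow_of_exponent_le hj1 (by linarith)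
  set q := d * jb y ^ (-(5/8) : ℝ) with hq
  have hq0 : 0 ≤ q := by positivity
  have e4 : d ^ (2 * s) * jb y ^ (-(5/8 * (2 * s))) = q ^ (2 * s) := by
    rw [hq, Real.mul_rpow hd0 (by positivity), ← Real.rpow_mul hj.le]; congr 2; ring
  have e5 : q ^ (2 * s) ≤ q + 1 := by
    rcases le_total q 1 with h | h
    · have := Real.rpow_le_one hq0 h (by linarith [hs.1] : 0 ≤ 2 * s)
      linarith
    · have := Real.rpow_le_rpow_of_exponent_le h (by linarith [hs.2] : 2 * s ≤ 1)
      rw [Real.rpow_one] at this; linarith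
  calc d ^ (2 * s) * jb y ^ (-(2 * b))
      ≤ d ^ (2 * s) * (jb y ^ (-(5/8 * (2 * s))) * jb y ^ (-(3/8 + 2 * ε))) := by gcongr
    _ = q ^ (2 * s) * jb y ^ (-(3/8 + 2 * ε)) := by rw [← mul_assoc, e4]
    _ ≤ (q + 1) * jb y ^ (-(3/8 + 2 * ε)) := by gcongr
    _ = d * jb y ^ (-(1 + 2 * ε)) + jb y ^ (-(3/8 + 2 * ε)) := by
      rw [add_mul, one_mul, hq, mul_assoc, ← Real.rpow_add hj]; congr 3; ring

end oneD

section cs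

lemma cs2 {X : Type*} [MeasurableSpace X] (μ : Measure X) (f g : X → ℝ≥0∞)
    (hf : Measurable f) (hg : Measurable g) :
    ∫⁻ x, f x * g x ∂μ ≤ (∫⁻ x, f x ^ 2 ∂μ) ^ (1/2 : ℝ) * (∫⁻ x, g x ^ 2 ∂μ) ^ (1/2 : ℝ) := by
  have h := ENNReal.lintegral_mul_le_Lp_mul_Lq μ (p := 2) (q := 2) Real.HolderConjugate.two_two
    hf.aemeasurable hg.aemeasurable
  simpa using h

lemma sq_half (a : ℝ≥0∞) : (a ^ (1/2 : ℝ)) ^ 2 = a := by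
  rw [← ENNReal.rpow_natCast, ← ENNReal.rpow_mul]; norm_num

lemma cs3 {X Y : Type*} [MeasurableSpace X] [MeasurableSpace Y] (μ : Measure X) (ν : Measure Y)
    [SFinite μ] [SFinite ν] (K D : X → Y → ℝ≥0∞) (A : X → ℝ≥0∞) (B : Y → ℝ≥0∞) (M N : ℝ≥0∞)
    (hK : Measurable (Function.uncurry K)) (hD : Measurable (Function.uncurry D))
    (hA : Measurable A) (hB : Measurable B)
    (hKM : ∀ x, ∫⁻ y, K x y ^ 2 ∂ν ≤ M) (hDN : ∀ y, ∫⁻ x, D x y ^ 2 ∂μ ≤ N) :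
    ∫⁻ x, ∫⁻ y, K x y * (A x * (B y * D x y)) ∂ν ∂μ ≤
      M ^ (1/2 : ℝ) * ((∫⁻ x, A x ^ 2 ∂μ) ^ (1/2 : ℝ) *
        ((∫⁻ y, B y ^ 2 ∂ν) ^ (1/2 : ℝ) * N ^ (1/2 : ℝ))) := by
  have hK' : ∀ x, Measurable (K x) := fun x => hK.comp measurable_prodMk_left
  have hD' : ∀ x, Measurable (D x) := fun x => hD.comp measurable_prodMk_left
  have hD'' : ∀ y, Measurable (fun x => D x y) := fun y => hD.comp measurable_prodMk_right
  have hE : Measurable (fun z : X × Y => (B z.2 * D z.1 z.2) ^ 2) :=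
    ((hB.comp measurable_snd).mul hD).pow_const 2
  set E : X → ℝ≥0∞ := fun x => ∫⁻ y, (B y * D x y) ^ 2 ∂ν with hEdef
  have mE : Measurable E := hE.lintegral_prod_right'
  have h1 : ∀ x, ∫⁻ y, K x y * (A x * (B y * D x y)) ∂ν ≤
      M ^ (1/2 : ℝ) * (A x * E x ^ (1/2 : ℝ)) := by
    intro x
    calc ∫⁻ y, K x y * (A x * (B y * D x y)) ∂ν
        = ∫⁻ y, A x * (K x y * (B y * D x y)) ∂ν := by
          congr 1; ext y; ring
      _ = A x * ∫⁻ y, K x y * (B y * D x y) ∂ν :=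
          lintegral_const_mul _ ((hK' x).mul (hB.mul (hD' x)))
      _ ≤ A x * (M ^ (1/2 : ℝ) * E x ^ (1/2 : ℝ)) := by
          gcongr
          refine (cs2 ν (K x) (fun y => B y * D x y) (hK' x) (hB.mul (hD' x))).trans ?_
          gcongr
          exact hKM x
      _ = _ := by ring
  have h2 : ∫⁻ x, E x ∂μ ≤ (∫⁻ y, B y ^ 2 ∂ν) * N := by
    calc ∫⁻ x, E x ∂μ = ∫⁻ y, ∫⁻ x, (B y * D x y) ^ 2 ∂μ ∂ν :=
          lintegral_lintegral_swap hE.aemeasurable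
      _ = ∫⁻ y, B y ^ 2 * ∫⁻ x, D x y ^ 2 ∂μ ∂ν := by
          congr 1; ext y
          rw [← lintegral_const_mul _ ((hD'' y).pow_const 2)]
          congr 1; ext x; ring
      _ ≤ ∫⁻ y, B y ^ 2 * N ∂ν := by
          apply lintegral_mono; intro y
          exact mul_le_mul_right (hDN y) _
      _ = _ := lintegral_mul_const _ (hB.pow_const 2)
  calc ∫⁻ x, ∫⁻ y, K x y * (A x * (B y * D x y)) ∂ν ∂μ
      ≤ ∫⁻ x, M ^ (1/2 : ℝ) * (A x * E x ^ (1/2 : ℝ)) ∂μ := lintegral_mono h1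
    _ = M ^ (1/2 : ℝ) * ∫⁻ x, A x * E x ^ (1/2 : ℝ) ∂μ :=
        lintegral_const_mul _ (hA.mul (mE.pow_const _))
    _ ≤ M ^ (1/2 : ℝ) * ((∫⁻ x, A x ^ 2 ∂μ) ^ (1/2 : ℝ) *
        (∫⁻ x, (E x ^ (1/2 : ℝ)) ^ 2 ∂μ) ^ (1/2 : ℝ)) := by
        gcongr
        exact cs2 μ _ _ hA (mE.pow_const _)
    _ ≤ _ := by
        simp_rw [sq_half]
        rw [← ENNReal.mul_rpow_of_nonneg (∫⁻ y, B y ^ 2 ∂ν) N (by norm_num : (0:ℝ) ≤ 1/2)]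
        gcongr

/-- weighted transform -/
def Wt (φ : ℝ → ℝ) (b : ℝ) (f : ℝ × ℝ → ℂ) (p : ℝ × ℝ) : ℝ≥0∞ :=
  ENNReal.ofReal (jb (p.2 + φ p.1) ^ b * ‖FT2 f p‖)

lemma Wt_meas (φ : ℝ → ℝ) (hφ : Continuous φ) (b : ℝ) (f : ℝ × ℝ → ℂ) : Measurable (Wt φ b f) := by
  unfold Wt
  have h1 := (FT2_continuous f).measurable
  have h2 := hφ.measurable
  fun_prop

lemma XNorm_eq (φ : ℝ → ℝ) (b : ℝ) (f : ℝ × ℝ → ℂ) :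
    XNorm φ 0 b f = (∫⁻ p, Wt φ b f p ^ 2) ^ (1/2 : ℝ) := by
  unfold XNorm Wt
  congr 2; ext p
  have hj := jb_pos (p.2 + φ p.1)
  rw [← ENNReal.ofReal_pow (by positivity)]
  congr 1
  rw [mul_zero, Real.rpow_zero, one_mul, mul_pow, ← Real.rpow_natCast (jb _ ^ b),
    ← Real.rpow_mul hj.le]
  rw [mul_comm b]; norm_num

def Nt (g : ℝ × ℝ → ℂ) (p : ℝ × ℝ) : ℝ≥0∞ := ENNReal.ofReal ‖FT2 g p‖

lemma Nt_meas (g : ℝ × ℝ → ℂ) : Measurable (Nt g) := by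
  unfold Nt
  have h1 := (FT2_continuous g).measurable
  fun_prop

/-- form where `x`-variable is `q.1` -/
lemma formG (K : ℝ × ℝ → ℝ × ℝ → ℝ≥0∞) (F G H : ℝ × ℝ → ℝ≥0∞) (M : ℝ≥0∞)
    (hK : Measurable (Function.uncurry K)) (hF : Measurable F) (hG : Measurable G)
    (hH : Measurable H) (hM : ∀ x, ∫⁻ y, K x y ^ 2 ≤ M) :
    ∫⁻ q : (ℝ × ℝ) × (ℝ × ℝ), K q.1 q.2 * F (q.1 + q.2) * G q.1 * H q.2 ≤
      M ^ (1/2 : ℝ) * ((∫⁻ p, F p ^ 2) ^ (1/2 : ℝ) * ((∫⁻ p, G p ^ 2) ^ (1/2 : ℝ) *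
        (∫⁻ p, H p ^ 2) ^ (1/2 : ℝ))) := by
  have m1 : Measurable (fun q : (ℝ × ℝ) × (ℝ × ℝ) => K q.1 q.2 * F (q.1 + q.2) * G q.1 * H q.2) :=
    ((hK.mul (hF.comp (by fun_prop))).mul (by fun_prop)).mul (by fun_prop)
  rw [Measure.volume_eq_prod, lintegral_prod _ m1.aemeasurable]
  have := cs3 volume volume K (fun x y => F (x + y)) G H M (∫⁻ p, F p ^ 2) hK
    (hF.comp (by fun_prop)) hG hH hM
    (fun y => (lintegral_add_right_eq_self (fun x => F x ^ 2) y).le)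
  refine le_trans (le_of_eq ?_) (this.trans (le_of_eq ?_))
  · congr 1; ext x; congr 1; ext y; ring
  · ring

lemma formH (K : ℝ × ℝ → ℝ × ℝ → ℝ≥0∞) (F G H : ℝ × ℝ → ℝ≥0∞) (M : ℝ≥0∞)
    (hK : Measurable (Function.uncurry K)) (hF : Measurable F) (hG : Measurable G)
    (hH : Measurable H) (hM : ∀ y, ∫⁻ x, K x y ^ 2 ≤ M) :
    ∫⁻ q : (ℝ × ℝ) × (ℝ × ℝ), K q.1 q.2 * F (q.1 + q.2) * G q.1 * H q.2 ≤
      M ^ (1/2 : ℝ) * ((∫⁻ p, F p ^ 2) ^ (1/2 : ℝ) * ((∫⁻ p, G p ^ 2) ^ (1/2 : ℝ) *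
        (∫⁻ p, H p ^ 2) ^ (1/2 : ℝ))) := by
  have m1 : Measurable (fun q : (ℝ × ℝ) × (ℝ × ℝ) => K q.1 q.2 * F (q.1 + q.2) * G q.1 * H q.2) :=
    ((hK.mul (hF.comp (by fun_prop))).mul (by fun_prop)).mul (by fun_prop)
  rw [Measure.volume_eq_prod, lintegral_prod_symm _ m1.aemeasurable]
  have := cs3 volume volume (fun y x => K x y) (fun y x => F (x + y)) H G M (∫⁻ p, F p ^ 2)
    (hK.comp measurable_swap)
    (hF.comp (by fun_prop)) hH hG hM
    (fun x => (lintegral_add_left_eq_self (fun y => F y ^ 2) x).le)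
  refine le_trans (le_of_eq ?_) (this.trans (le_of_eq ?_))
  · congr 1; ext x; congr 1; ext y; ring
  · ring

lemma formF (K : ℝ × ℝ → ℝ × ℝ → ℝ≥0∞) (F G H : ℝ × ℝ → ℝ≥0∞) (M : ℝ≥0∞)
    (hK : Measurable (Function.uncurry K)) (hF : Measurable F) (hG : Measurable G)
    (hH : Measurable H) (hM : ∀ z, ∫⁻ x, K x (z - x) ^ 2 ≤ M) :
    ∫⁻ q : (ℝ × ℝ) × (ℝ × ℝ), K q.1 q.2 * F (q.1 + q.2) * G q.1 * H q.2 ≤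
      M ^ (1/2 : ℝ) * ((∫⁻ p, F p ^ 2) ^ (1/2 : ℝ) * ((∫⁻ p, G p ^ 2) ^ (1/2 : ℝ) *
        (∫⁻ p, H p ^ 2) ^ (1/2 : ℝ))) := by
  have m1 : Measurable (fun q : (ℝ × ℝ) × (ℝ × ℝ) => K q.1 q.2 * F (q.1 + q.2) * G q.1 * H q.2) :=
    ((hK.mul (hF.comp (by fun_prop))).mul (by fun_prop)).mul (by fun_prop)
  have mm : Measurable (fun q : (ℝ × ℝ) × (ℝ × ℝ) => (q.2, q.1 - q.2)) := by fun_prop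
  have hK' : Measurable (Function.uncurry fun z x : ℝ × ℝ => K x (z - x)) := hK.comp mm
  have m2 : Measurable (fun q : (ℝ × ℝ) × (ℝ × ℝ) =>
      K q.1 (q.2 - q.1) * F q.2 * G q.1 * H (q.2 - q.1)) := by
    have : Measurable (fun q : (ℝ × ℝ) × (ℝ × ℝ) => K q.1 (q.2 - q.1)) :=
      hK'.comp measurable_swap
    fun_prop
  rw [Measure.volume_eq_prod, lintegral_prod _ m1.aemeasurable]
  have := cs3 volume volume (fun z x => K x (z - x)) (fun z x => H (z - x)) F G M (∫⁻ p, H p ^ 2)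
    hK' (hH.comp (by fun_prop)) hF hG hM
    (fun x => (lintegral_sub_right_eq_self (fun y => H y ^ 2) x).le)
  refine le_trans (le_of_eq ?_) (this.trans (le_of_eq ?_))
  · calc _ = ∫⁻ x : ℝ × ℝ, ∫⁻ z : ℝ × ℝ, K x (z - x) * F z * G x * H (z - x) := by
          congr 1; ext x
          rw [← lintegral_sub_right_eq_self (μ := volume) _ x]
          congr 1; ext z; simp
      _ = ∫⁻ z : ℝ × ℝ, ∫⁻ x : ℝ × ℝ, K x (z - x) * F z * G x * H (z - x) :=
          lintegral_lintegral_swap m2.aemeasurable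
      _ = _ := by congr 1; ext x; congr 1; ext y; ring
  · ring
end cs

section kern

def K1 (s b ε : ℝ) (x y : ℝ × ℝ) : ℝ :=
  |3 * y.1 ^ 2 + 2 * (x.1 + y.1)| ^ s * jb (x.2 + y.2 + (x.1 + y.1) ^ 2) ^ (-b) *
    jb (y.2 + -y.1 ^ 3) ^ (-(1/2 + ε))

def KB (ε : ℝ) (x y : ℝ × ℝ) : ℝ :=
  |y.1| ^ (1/2 : ℝ) * jb (x.2 + y.2 + (x.1 + y.1) ^ 2) ^ (-(1/2 + ε)) *
    jb (x.2 + x.1 ^ 2) ^ (-(1/2 + ε))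

def KA (ε : ℝ) (x y : ℝ × ℝ) : ℝ :=
  (if |y.1| ≤ jb (x.2 + y.2 + (x.1 + y.1) ^ 2) ^ (1/2 : ℝ) then
    jb (x.2 + y.2 + (x.1 + y.1) ^ 2) ^ (-(1/4) : ℝ) else 0) *
    jb (x.2 + x.1 ^ 2) ^ (-(1/2 + ε))

lemma K1_meas (s b ε : ℝ) : Measurable (Function.uncurry fun x y => ENNReal.ofReal (K1 s b ε x y)) := by
  unfold K1 Function.uncurry; fun_prop

lemma KB_meas (ε : ℝ) : Measurable (Function.uncurry fun x y => ENNReal.ofReal (KB ε x y)) := by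
  unfold KB Function.uncurry; fun_prop

lemma KA_meas (ε : ℝ) : Measurable (Function.uncurry fun x y => ENNReal.ofReal (KA ε x y)) := by
  unfold KA Function.uncurry
  apply Measurable.ennreal_ofReal
  apply Measurable.mul
  · apply Measurable.ite
    · exact measurableSet_le (by fun_prop) (by fun_prop)
    · fun_prop
    · fun_prop
  · fun_prop

lemma jb_sq (y ε : ℝ) : (jb y ^ (-(1/2 + ε))) ^ 2 = jb y ^ (-(1 + 2 * ε)) := by
  rw [← Real.rpow_natCast, ← Real.rpow_mul (jb_pos y).le]; congr 1; push_cast; ring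

lemma K1_bound {s b ε : ℝ} (hs : s ∈ Set.Icc (0 : ℝ) (1/2)) (hb : 3/16 + (5/8 : ℝ) * s + ε ≤ b)
    (hε : 0 < ε) : ∃ M : ℝ≥0∞, M < ⊤ ∧ ∀ x, ∫⁻ y, ENNReal.ofReal (K1 s b ε x y) ^ 2 ≤ M := by
  obtain ⟨M, hM, h⟩ := L3 hs hb hε
  refine ⟨M * Jint (1 + 2 * ε), ENNReal.mul_lt_top hM (Jint_lt_top (by linarith)), fun x => ?_⟩
  have m1 : Measurable (fun y => ENNReal.ofReal (K1 s b ε x y) ^ 2) :=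
    ((K1_meas s b ε).comp measurable_prodMk_left).pow_const 2
  rw [Measure.volume_eq_prod, lintegral_prod _ m1.aemeasurable]
  have m2 : Measurable (fun q : ℝ × ℝ => ENNReal.ofReal (K1 s b ε x (q.1, q.2 + q.1 ^ 3)) ^ 2) :=
    m1.comp (by fun_prop)
  calc _ = ∫⁻ u : ℝ, ∫⁻ v : ℝ, ENNReal.ofReal (K1 s b ε x (u, v + u ^ 3)) ^ 2 := by
        congr 1; ext u
        exact (lintegral_add_right_eq_self (μ := volume)
          (fun v => ENNReal.ofReal (K1 s b ε x (u, v)) ^ 2) (u ^ 3)).symm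
    _ = ∫⁻ v : ℝ, ∫⁻ u : ℝ, ENNReal.ofReal (K1 s b ε x (u, v + u ^ 3)) ^ 2 :=
        lintegral_lintegral_swap m2.aemeasurable
    _ ≤ ∫⁻ v : ℝ, M * ENNReal.ofReal (jb v ^ (-(1 + 2 * ε))) := by
        apply lintegral_mono; intro v
        refine le_trans (le_of_eq ?_) (mul_le_mul_left (h x.1 (x.2 + v)) _)
        beta_reduce
        rw [← lintegral_mul_const _ (by fun_prop)]
        refine lintegral_congr (fun u => ?_)
        have hj := jb_pos v
        have hj2 := jb_pos (x.2 + v + (x.1 + u) ^ 2 + u ^ 3)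
        have e1 : x.2 + (v + u ^ 3) + (x.1 + u) ^ 2 = x.2 + v + (x.1 + u) ^ 2 + u ^ 3 := by ring
        have e2 : v + u ^ 3 + -u ^ 3 = v := by ring
        simp only [K1, e1, e2]
        rw [← ENNReal.ofReal_pow (by positivity), ← ENNReal.ofReal_mul (by positivity),
          mul_pow, mul_pow, jb_sq]
    _ = M * Jint (1 + 2 * ε) := by
        rw [lintegral_const_mul _ (by fun_prop), Jint]

lemma lin_bound (k c r : ℝ) :
    ∫⁻ x : ℝ, ENNReal.ofReal (|k| * jb (c + 2 * k * x) ^ (-r)) ≤ Jint r := by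
  by_cases hk : k = 0
  · simp [hk]
  have hd : ∀ x ∈ (univ : Set ℝ), HasDerivWithinAt (fun x : ℝ => c + 2 * k * x) (2 * k) univ x := by
    intro x _
    apply HasDerivAt.hasDerivWithinAt
    simpa using ((hasDerivAt_id x).const_mul (2 * k)).const_add c
  have hinj : InjOn (fun x : ℝ => c + 2 * k * x) univ := by
    intro x _ y _ h
    have h : c + 2 * k * x = c + 2 * k * y := h
    have : k * (x - y) = 0 := by linarith
    rcases mul_eq_zero.1 this with h | h
    · exact absurd h hk
    · linarith
  have h := lintegral_image_eq_lintegral_abs_deriv_mul MeasurableSet.univ hd hinj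
    (fun y => ENNReal.ofReal (jb y ^ (-r)))
  rw [Measure.restrict_univ] at h
  calc _ ≤ ∫⁻ x, ENNReal.ofReal |2 * k| *
        ENNReal.ofReal (jb (c + 2 * k * x) ^ (-r)) := by
        apply lintegral_mono; intro x
        have hj := jb_pos (c + 2 * k * x)
        show _ ≤ ENNReal.ofReal |2 * k| * ENNReal.ofReal (jb (c + 2 * k * x) ^ (-r))
        rw [← ENNReal.ofReal_mul (abs_nonneg _)]
        apply ENNReal.ofReal_le_ofReal
        have hk2 : |k| ≤ |2 * k| := by
          rw [abs_mul, abs_two]; linarith [abs_nonneg k]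
        exact mul_le_mul_of_nonneg_right hk2 (by positivity)
    _ = _ := h.symm
    _ ≤ _ := setLIntegral_le_lintegral _ _

lemma KB_bound (ε : ℝ) (y : ℝ × ℝ) :
    ∫⁻ x, ENNReal.ofReal (KB ε x y) ^ 2 ≤ Jint (1 + 2 * ε) * Jint (1 + 2 * ε) := by
  have m1 : Measurable (fun x => ENNReal.ofReal (KB ε x y) ^ 2) :=
    ((KB_meas ε).comp measurable_prodMk_right).pow_const 2
  rw [Measure.volume_eq_prod, lintegral_prod _ m1.aemeasurable]
  have m2 : Measurable (fun q : ℝ × ℝ => ENNReal.ofReal (KB ε (q.1, q.2 - q.1 ^ 2) y) ^ 2) :=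
    m1.comp (by fun_prop)
  calc _ = ∫⁻ u : ℝ, ∫⁻ v : ℝ, ENNReal.ofReal (KB ε (u, v - u ^ 2) y) ^ 2 := by
        congr 1; ext u
        exact (lintegral_sub_right_eq_self (μ := volume)
          (fun v => ENNReal.ofReal (KB ε (u, v) y) ^ 2) (u ^ 2)).symm
    _ = ∫⁻ v : ℝ, ∫⁻ u : ℝ, ENNReal.ofReal (KB ε (u, v - u ^ 2) y) ^ 2 :=
        lintegral_lintegral_swap m2.aemeasurable
    _ ≤ ∫⁻ v : ℝ, Jint (1 + 2 * ε) * ENNReal.ofReal (jb v ^ (-(1 + 2 * ε))) := by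
        apply lintegral_mono; intro v
        refine le_trans (le_of_eq ?_)
          (mul_le_mul_left (lin_bound y.1 (v + y.2 + y.1 ^ 2) (1 + 2 * ε)) _)
        beta_reduce
        rw [← lintegral_mul_const _ (by fun_prop)]
        refine lintegral_congr (fun u => ?_)
        have hj := jb_pos v
        have hj2 := jb_pos (v + y.2 + y.1 ^ 2 + 2 * y.1 * u)
        have e1 : v - u ^ 2 + y.2 + (u + y.1) ^ 2 = v + y.2 + y.1 ^ 2 + 2 * y.1 * u := by ring
        have e2 : v - u ^ 2 + u ^ 2 = v := by ring
        have e3 : (|y.1| ^ (1/2 : ℝ)) ^ 2 = |y.1| := by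
          rw [← Real.rpow_natCast, ← Real.rpow_mul (abs_nonneg _)]; norm_num
        simp only [KB, e1, e2]
        rw [← ENNReal.ofReal_pow (by positivity), ← ENNReal.ofReal_mul (by positivity),
          mul_pow, mul_pow, jb_sq, jb_sq, e3]
    _ = _ := by
        rw [lintegral_const_mul _ (by fun_prop)]; rfl

lemma KA_bound (ε : ℝ) (z : ℝ × ℝ) :
    ∫⁻ x, ENNReal.ofReal (KA ε x (z - x)) ^ 2 ≤ 2 * Jint (1 + 2 * ε) := by
  have mm : Measurable (fun x : ℝ × ℝ => (x, z - x)) := by fun_prop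
  have m1 : Measurable (fun x => ENNReal.ofReal (KA ε x (z - x)) ^ 2) :=
    ((KA_meas ε).comp mm).pow_const 2
  rw [Measure.volume_eq_prod, lintegral_prod _ m1.aemeasurable]
  set j := jb (z.2 + z.1 ^ 2) with hj
  have hj0 : 0 < j := jb_pos _
  set S : Set ℝ := Icc (z.1 - j ^ (1/2 : ℝ)) (z.1 + j ^ (1/2 : ℝ)) with hS
  have h1 : ∀ u v : ℝ, ENNReal.ofReal (KA ε (u, v) (z - (u, v))) ^ 2 =
      S.indicator (fun _ => ENNReal.ofReal (j ^ (-(1/2) : ℝ))) u *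
        ENNReal.ofReal (jb (v + u ^ 2) ^ (-(1 + 2 * ε))) := by
    intro u v
    have hw := jb_pos (v + u ^ 2)
    have e1 : v + (z.2 - v) + (u + (z.1 - u)) ^ 2 = z.2 + z.1 ^ 2 := by ring
    have e2 : (j ^ (-(1/4) : ℝ)) ^ 2 = j ^ (-(1/2) : ℝ) := by
      rw [← Real.rpow_natCast, ← Real.rpow_mul hj0.le]; norm_num
    simp only [KA, Prod.fst_sub, Prod.snd_sub, e1, ← hj]
    by_cases hu : |z.1 - u| ≤ j ^ (1/2 : ℝ)
    · have : u ∈ S := by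
        rw [abs_le] at hu
        exact ⟨by linarith [hu.2], by linarith [hu.1]⟩
      rw [if_pos hu, indicator_of_mem this, ← ENNReal.ofReal_mul (by positivity),
        ← ENNReal.ofReal_pow (by positivity), mul_pow, e2, jb_sq]
    · have : u ∉ S := by
        intro h
        apply hu
        rw [abs_le]
        exact ⟨by linarith [h.2], by linarith [h.1]⟩
      rw [if_neg hu, indicator_of_notMem this]; simp
  calc _ = ∫⁻ u : ℝ, S.indicator (fun _ => ENNReal.ofReal (j ^ (-(1/2) : ℝ))) u *
        Jint (1 + 2 * ε) := by
        congr 1; ext u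
        simp_rw [h1]
        rw [lintegral_const_mul _ (by fun_prop),
          lintegral_add_right_eq_self (μ := volume)
            (fun v => ENNReal.ofReal (jb v ^ (-(1 + 2 * ε)))) (u ^ 2)]
        rfl
    _ = ENNReal.ofReal (j ^ (-(1/2) : ℝ)) * volume S * Jint (1 + 2 * ε) := by
        rw [lintegral_mul_const _ (measurable_const.indicator measurableSet_Icc),
          lintegral_indicator_const measurableSet_Icc]
    _ ≤ 2 * Jint (1 + 2 * ε) := by
        gcongr
        rw [hS, Real.volume_Icc, ← ENNReal.ofReal_mul (by positivity)]
        have : j ^ (-(1/2) : ℝ) * (z.1 + j ^ (1/2 : ℝ) - (z.1 - j ^ (1/2 : ℝ))) = 2 := by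
          have : j ^ (-(1/2) : ℝ) * j ^ (1/2 : ℝ) = 1 := by
            rw [← Real.rpow_add hj0]; norm_num
          linear_combination 2 * this
        rw [this]; simp

lemma split_bound {s b ε d j : ℝ} (hs : s ∈ Set.Icc (0 : ℝ) (1/2))
    (hb : 1/4 + (1/2 : ℝ) * s + ε ≤ b) (hε : 0 < ε) (hd : 0 ≤ d) (hj : 1 ≤ j) :
    d ^ s * j ^ (-b) ≤ (if d ≤ j ^ (1/2 : ℝ) then j ^ (-(1/4) : ℝ) else 0) +
      d ^ (1/2 : ℝ) * j ^ (-(1/2 + ε)) := by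
  have hj0 : 0 < j := by linarith
  split_ifs with h
  · have : d ^ s ≤ (j ^ (1/2 : ℝ)) ^ s := Real.rpow_le_rpow hd h hs.1
    have h2 : d ^ s * j ^ (-b) ≤ j ^ (-(1/4) : ℝ) := by
      calc d ^ s * j ^ (-b) ≤ (j ^ (1/2 : ℝ)) ^ s * j ^ (-b) := by gcongr
        _ = j ^ (1/2 * s + -b) := by rw [← Real.rpow_mul hj0.le, ← Real.rpow_add hj0]
        _ ≤ _ := Real.rpow_le_rpow_of_exponent_le hj (by linarith)
    have : 0 ≤ d ^ (1/2 : ℝ) * j ^ (-(1/2 + ε)) := by positivity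
    linarith
  · push Not at h
    have hd0 : 0 < d := lt_of_le_of_lt (by positivity) h
    rw [zero_add]
    calc d ^ s * j ^ (-b) ≤ d ^ s * ((j ^ (1/2 : ℝ)) ^ (1/2 - s) * j ^ (-(1/2 + ε))) := by
          gcongr
          rw [← Real.rpow_mul hj0.le, ← Real.rpow_add hj0]
          exact Real.rpow_le_rpow_of_exponent_le hj (by linarith)
      _ ≤ d ^ s * (d ^ (1/2 - s) * j ^ (-(1/2 + ε))) := by
          gcongr
          linarith [hs.2]
      _ = _ := by
          rw [← mul_assoc, ← Real.rpow_add hd0]; congr 2; ring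

lemma nn_re {f : ℝ × ℝ → ℂ} (hf : HasNonnegFT f) (p : ℝ × ℝ) : (FT2 f p).re = ‖FT2 f p‖ := by
  have h := hf p
  rw [← Complex.abs_re_eq_norm.2 h.1, abs_of_nonneg h.2]

lemma part1 {s b ε : ℝ} (hs : s ∈ Set.Icc (0 : ℝ) (1/2)) (hb : 3/16 + (5/8 : ℝ) * s + ε ≤ b)
    (hε : 0 < ε) : ∃ C : ℝ≥0∞, C < ⊤ ∧ ∀ f g h : ℝ × ℝ → ℂ,
      HasNonnegFT f → HasNonnegFT g → HasNonnegFT h →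
      Itri (fun ξ₁ ξ₂ => |3 * ξ₂ ^ 2 + 2 * (ξ₁ + ξ₂)| ^ s) (FT2 f) (FT2 g) (FT2 h) ≤
        C * (XNorm SchPhase 0 b f * (eLpNorm g 2 volume * XNorm AiryPhase 0 (1/2 + ε) h)) := by
  obtain ⟨M, hM, hKM⟩ := K1_bound hs hb hε
  refine ⟨M ^ (1/2 : ℝ), ENNReal.rpow_lt_top_of_nonneg (by norm_num) hM.ne, ?_⟩
  intro f g h hf hg hh
  have cS : Continuous SchPhase := by unfold SchPhase; fun_prop
  have cA : Continuous AiryPhase := by unfold AiryPhase; fun_prop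
  have := formG (fun x y => ENNReal.ofReal (K1 s b ε x y)) (Wt SchPhase b f) (Nt g)
    (Wt AiryPhase (1/2 + ε) h) M (K1_meas s b ε) (Wt_meas _ cS _ _) (Nt_meas _) (Wt_meas _ cA _ _)
    hKM
  rw [← XNorm_eq, ← XNorm_eq] at this
  refine le_trans (le_of_eq ?_) (this.trans ?_)
  · unfold Itri
    congr 1; ext ⟨x, y⟩
    simp only [Wt, Nt, K1, nn_re hf, nn_re hg, nn_re hh, SchPhase, AiryPhase, Prod.fst_add,
      Prod.snd_add]
    have hj := jb_pos (x.2 + y.2 + (x.1 + y.1) ^ 2)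
    have hj2 := jb_pos (y.2 + -y.1 ^ 3)
    rw [← ENNReal.ofReal_mul (by positivity), ← ENNReal.ofReal_mul (by positivity),
      ← ENNReal.ofReal_mul (by positivity)]
    congr 1
    have e1 : jb (x.2 + y.2 + (x.1 + y.1) ^ 2) ^ (-b) * jb (x.2 + y.2 + (x.1 + y.1) ^ 2) ^ b = 1 := by
      rw [← Real.rpow_add hj]; simp
    have e2 : jb (y.2 + -y.1 ^ 3) ^ (-(1/2 + ε)) * jb (y.2 + -y.1 ^ 3) ^ (1/2 + ε) = 1 := by
      rw [← Real.rpow_add hj2]; simp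
    have e3 : (x.1 + y.1, x.2 + y.2) = x + y := rfl
    rw [e3]
    generalize jb (x.2 + y.2 + (x.1 + y.1) ^ 2) ^ (-b) = A1 at *
    generalize jb (x.2 + y.2 + (x.1 + y.1) ^ 2) ^ b = A2 at *
    generalize jb (y.2 + -y.1 ^ 3) ^ (-(1/2 + ε)) = A3 at *
    generalize jb (y.2 + -y.1 ^ 3) ^ (1/2 + ε) = A4 at *
    generalize |3 * y.1 ^ 2 + 2 * (x.1 + y.1)| ^ s = A5 at *
    calc _ = A5 * ‖FT2 f (x + y)‖ * ‖FT2 g x‖ * ‖FT2 h y‖ * 1 * 1 := by ring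
      _ = A5 * ‖FT2 f (x + y)‖ * ‖FT2 g x‖ * ‖FT2 h y‖ * (A1 * A2) * (A3 * A4) := by rw [e1, e2]
      _ = _ := by ring
  · have := planch g
    gcongr
    exact this

lemma part2 {s b ε : ℝ} (hs : s ∈ Set.Icc (0 : ℝ) (1/2)) (hb : 1/4 + (1/2 : ℝ) * s + ε ≤ b)
    (hε : 0 < ε) : ∃ C : ℝ≥0∞, C < ⊤ ∧ ∀ f g h : ℝ × ℝ → ℂ,
      HasNonnegFT f → HasNonnegFT g → HasNonnegFT h →
      Itri (fun _ ξ₂ => |ξ₂| ^ s) (FT2 f) (FT2 g) (FT2 h) ≤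
        C * (XNorm SchPhase 0 b f * (XNorm SchPhase 0 (1/2 + ε) g * eLpNorm h 2 volume)) := by
  have hJ := Jint_lt_top (r := 1 + 2 * ε) (by linarith)
  refine ⟨(2 * Jint (1 + 2 * ε)) ^ (1/2 : ℝ) + (Jint (1 + 2 * ε) * Jint (1 + 2 * ε)) ^ (1/2 : ℝ),
    ENNReal.add_lt_top.2 ⟨ENNReal.rpow_lt_top_of_nonneg (by norm_num)
      (ENNReal.mul_lt_top (by simp) hJ).ne,
      ENNReal.rpow_lt_top_of_nonneg (by norm_num) (ENNReal.mul_lt_top hJ hJ).ne⟩, ?_⟩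
  intro f g h hf hg hh
  have cS : Continuous SchPhase := by unfold SchPhase; fun_prop
  have wf := Wt_meas SchPhase cS b f
  have wg := Wt_meas SchPhase cS (1/2 + ε) g
  have wh := Nt_meas h
  have HA := formF (fun x y => ENNReal.ofReal (KA ε x y)) (Wt SchPhase b f)
    (Wt SchPhase (1/2 + ε) g) (Nt h) _ (KA_meas ε) wf wg wh (KA_bound ε)
  have HB := formH (fun x y => ENNReal.ofReal (KB ε x y)) (Wt SchPhase b f)
    (Wt SchPhase (1/2 + ε) g) (Nt h) _ (KB_meas ε) wf wg wh (KB_bound ε)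
  rw [← XNorm_eq, ← XNorm_eq] at HA HB
  have mA : Measurable (fun q : (ℝ × ℝ) × (ℝ × ℝ) => ENNReal.ofReal (KA ε q.1 q.2) *
      Wt SchPhase b f (q.1 + q.2) * Wt SchPhase (1/2 + ε) g q.1 * Nt h q.2) := by
    have := KA_meas ε
    unfold Function.uncurry at this
    fun_prop
  calc Itri (fun _ ξ₂ => |ξ₂| ^ s) (FT2 f) (FT2 g) (FT2 h)
      ≤ ∫⁻ q : (ℝ × ℝ) × (ℝ × ℝ), (ENNReal.ofReal (KA ε q.1 q.2) *
          Wt SchPhase b f (q.1 + q.2) * Wt SchPhase (1/2 + ε) g q.1 * Nt h q.2 +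
          ENNReal.ofReal (KB ε q.1 q.2) *
          Wt SchPhase b f (q.1 + q.2) * Wt SchPhase (1/2 + ε) g q.1 * Nt h q.2) := by
        unfold Itri
        apply lintegral_mono
        rintro ⟨x, y⟩
        simp only [Wt, Nt, nn_re hf, nn_re hg, nn_re hh, SchPhase, Prod.fst_add, Prod.snd_add]
        have hj := jb_pos (x.2 + y.2 + (x.1 + y.1) ^ 2)
        have hj2 := jb_pos (x.2 + x.1 ^ 2)
        have pA : 0 ≤ KA ε x y := by
          unfold KA
          split_ifs <;> positivity
        have pB : 0 ≤ KB ε x y := by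
          unfold KB; positivity
        rw [← ENNReal.ofReal_mul pA, ← ENNReal.ofReal_mul pB,
          ← ENNReal.ofReal_mul (by positivity), ← ENNReal.ofReal_mul (by positivity),
          ← ENNReal.ofReal_mul (by positivity), ← ENNReal.ofReal_mul (by positivity),
          ← ENNReal.ofReal_add (by positivity) (by positivity)]
        apply ENNReal.ofReal_le_ofReal
        have e1 : jb (x.2 + y.2 + (x.1 + y.1) ^ 2) ^ (-b) *
            jb (x.2 + y.2 + (x.1 + y.1) ^ 2) ^ b = 1 := by
          rw [← Real.rpow_add hj]; simp
        have e2 : jb (x.2 + x.1 ^ 2) ^ (-(1/2 + ε)) * jb (x.2 + x.1 ^ 2) ^ (1/2 + ε) = 1 := by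
          rw [← Real.rpow_add hj2]; simp
        have e3 : (x.1 + y.1, x.2 + y.2) = x + y := rfl
        have hsp := split_bound hs hb hε (abs_nonneg y.1)
          (jb_one_le (x.2 + y.2 + (x.1 + y.1) ^ 2))
        rw [e3]
        have hsp2 : |y.1| ^ s * jb (x.2 + y.2 + (x.1 + y.1) ^ 2) ^ (-b) *
            jb (x.2 + x.1 ^ 2) ^ (-(1/2 + ε)) ≤ KA ε x y + KB ε x y := by
          unfold KA KB
          rw [← add_mul]
          gcongr
        have q2 : 0 ≤ jb (x.2 + y.2 + (x.1 + y.1) ^ 2) ^ b := by positivity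
        have q4 : 0 ≤ jb (x.2 + x.1 ^ 2) ^ (1/2 + ε) := by positivity
        generalize jb (x.2 + y.2 + (x.1 + y.1) ^ 2) ^ (-b) = A1 at *
        generalize jb (x.2 + y.2 + (x.1 + y.1) ^ 2) ^ b = A2 at *
        generalize jb (x.2 + x.1 ^ 2) ^ (-(1/2 + ε)) = A3 at *
        generalize jb (x.2 + x.1 ^ 2) ^ (1/2 + ε) = A4 at *
        generalize |y.1| ^ s = A5 at *
        calc A5 * ‖FT2 f (x + y)‖ * ‖FT2 g x‖ * ‖FT2 h y‖
            = A5 * ‖FT2 f (x + y)‖ * ‖FT2 g x‖ * ‖FT2 h y‖ * 1 * 1 := by ring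
          _ = A5 * ‖FT2 f (x + y)‖ * ‖FT2 g x‖ * ‖FT2 h y‖ * (A1 * A2) * (A3 * A4) := by
              rw [e1, e2]
          _ = (A5 * A1 * A3) * (A2 * ‖FT2 f (x + y)‖ * (A4 * ‖FT2 g x‖) * ‖FT2 h y‖) := by ring
          _ ≤ (KA ε x y + KB ε x y) * (A2 * ‖FT2 f (x + y)‖ * (A4 * ‖FT2 g x‖) * ‖FT2 h y‖) := by
              gcongr
          _ = _ := by ring
    _ ≤ ((2 * Jint (1 + 2 * ε)) ^ (1/2 : ℝ) + (Jint (1 + 2 * ε) * Jint (1 + 2 * ε)) ^ (1/2 : ℝ)) *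
        (XNorm SchPhase 0 b f * (XNorm SchPhase 0 (1/2 + ε) g *
          (∫⁻ p, Nt h p ^ 2) ^ (1/2 : ℝ))) := by
        rw [lintegral_add_left mA, add_mul]
        exact add_le_add HA HB
    _ ≤ _ := by
        have := planch h
        gcongr
        exact this
end kern

/-- the interpolated trilinear estimates for `I^s_2` and `I^s_3`. -/
theorem stmt5 (s ρ₂ ρ₃ ε : ℝ) (hs : s ∈ Set.Icc (0 : ℝ) (1/2))
    (hρ₂ : 3/16 + (5/8 : ℝ) * s ≤ ρ₂) (hρ₃ : 1/4 + (1/2 : ℝ) * s ≤ ρ₃) (hε : 0 < ε) :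
    ∃ C : ℝ, 0 < C ∧
      ∀ f g h : ℝ × ℝ → ℂ, HasNonnegFT f → HasNonnegFT g → HasNonnegFT h →
        (Itri (fun ξ₁ ξ₂ => |3 * ξ₂ ^ 2 + 2 * (ξ₁ + ξ₂)| ^ s) (FT2 f) (FT2 g) (FT2 h) ≤
            ENNReal.ofReal C * XNorm SchPhase 0 (ρ₂ + ε) f * eLpNorm g 2 volume *
              XNorm AiryPhase 0 (1/2 + ε) h) ∧
        (Itri (fun _ ξ₂ => |ξ₂| ^ s) (FT2 f) (FT2 g) (FT2 h) ≤
            ENNReal.ofReal C * XNorm SchPhase 0 (ρ₃ + ε) f * XNorm SchPhase 0 (1/2 + ε) g *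
              eLpNorm h 2 volume) := by

  obtain ⟨C1, h1, H1⟩ := part1 (b := ρ₂ + ε) hs (by linarith) hε
  obtain ⟨C2, h2, H2⟩ := part2 (b := ρ₃ + ε) hs (by linarith) hε
  refine ⟨C1.toReal + C2.toReal + 1, by positivity, fun f g h hf hg hh => ⟨?_, ?_⟩⟩
  · refine (H1 f g h hf hg hh).trans ?_
    rw [mul_assoc, mul_assoc]
    gcongr
    rw [← ENNReal.ofReal_toReal h1.ne]
    apply ENNReal.ofReal_le_ofReal
    rw [ENNReal.toReal_ofReal ENNReal.toReal_nonneg]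
    linarith [ENNReal.toReal_nonneg (a := C2)]
  · refine (H2 f g h hf hg hh).trans ?_
    rw [mul_assoc, mul_assoc]
    gcongr
    rw [← ENNReal.ofReal_toReal h2.ne]
    apply ENNReal.ofReal_le_ofReal
    rw [ENNReal.toReal_ofReal ENNReal.toReal_nonneg]
    linarith [ENNReal.toReal_nonneg (a := C1)]

end
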